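/- arXiv:1502.07955 — 3 statements merged into one kernel-verified Lean document; each statement's English description precedes it below -/
import Mathlib

section
/- Let N ≥ 3 be an integer, α > 0, and k(α) = (2N-2+α)/(2+α). Let F : ℝ → ℝ be continuously differentiable. Suppose V ∈ C²((0,∞)) is positive, satisfies -V''(t) - (k(α)/t)V'(t) = F(V(t)) for all t > 0, and lim_{t→0⁺} V'(t) = 0 and lim_{t→∞} V(t) = 0. Then the radial function u(x) = V((2/(2+α))·|x|^{(2+α)/2}) extends continuously to ℝ^N, is positive, twice continuously differentiable on ℝ^N∖{0}, satisfies -Δu(x) = |x|^α F(u(x)) for every x ≠ 0, and u(x) → 0 as |x| → ∞. -/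
open MeasureTheory Filter Set Topology

/-- The Euclidean Laplacian: sum of second partial derivatives. -/
noncomputable def lap {N : ℕ} (u : EuclideanSpace ℝ (Fin N) → ℝ)
    (x : EuclideanSpace ℝ (Fin N)) : ℝ :=
  ∑ i : Fin N, fderiv ℝ (fun y => fderiv ℝ u y (EuclideanSpace.single i 1)) x
    (EuclideanSpace.single i 1)

/-- k(α) = (2N-2+α)/(2+α). -/
noncomputable def kk (N : ℕ) (α : ℝ) : ℝ := (2 * (N : ℝ) - 2 + α) / (2 + α)

theorem hasDerivAt_deriv_of_contDiffOn_two {V : ℝ → ℝ} (hV : ContDiffOn ℝ 2 V (Ioi 0)) :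
    (∀ t > (0:ℝ), HasDerivAt V (deriv V t) t) ∧
    ∀ t > (0:ℝ), HasDerivAt (deriv V) (deriv (deriv V) t) t := by
  refine ⟨fun t ht => ?_, fun t ht => ?_⟩
  · exact ((hV.differentiableOn (by norm_num)).differentiableAt (Ioi_mem_nhds ht)).hasDerivAt
  · have h := ((contDiffOn_succ_iff_deriv_of_isOpen (n := 1) isOpen_Ioi).1 (by rw [one_add_one_eq_two]; exact hV)).2.2
    exact ((h.differentiableOn (by norm_num)).differentiableAt (Ioi_mem_nhds ht)).hasDerivAt

theorem hasDerivAt_flux {V : ℝ → ℝ} {k c t a : ℝ} (hk : 0 < k) (ht : 0 < t)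
    (h : HasDerivAt (deriv V) a t) :
    HasDerivAt (fun s => s ^ k * deriv V s - c / (k + 1) * s ^ (k + 1))
      (t ^ k * (a + k / t * deriv V t - c)) t := by
  have h1 := ((Real.hasDerivAt_rpow_const (p := k) (Or.inl ht.ne')).mul h).sub
    ((Real.hasDerivAt_rpow_const (p := k + 1) (Or.inl ht.ne')).const_mul (c / (k + 1)))
  refine h1.congr_deriv ?_
  rw [Real.rpow_sub_one ht.ne', add_sub_cancel_right]
  field_simp
  ring

theorem hasDerivAt_sub_quadratic {V : ℝ → ℝ} {c t a : ℝ} (h : HasDerivAt V a t) :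
    HasDerivAt (fun s => V s - c / 2 * s ^ 2) (a - c * t) t := by
  refine (h.sub ((hasDerivAt_pow 2 t).const_mul (c / 2))).congr_deriv ?_
  simp; ring

theorem exists_tendsto_of_deriv {V : ℝ → ℝ} (h1 : ∀ t > (0:ℝ), HasDerivAt V (deriv V t) t)
    (hpos : ∀ t > (0:ℝ), 0 < V t) (h0 : Tendsto (deriv V) (𝓝[>] 0) (𝓝 0)) :
    ∃ l, 0 ≤ l ∧ Tendsto V (𝓝[>] 0) (𝓝 l) := by
  obtain ⟨d, hd, hd'⟩ := mem_nhdsGT_iff_exists_Ioo_subset.1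
    (h0.eventually (lt_mem_nhds (show (-1:ℝ) < 0 by norm_num)))
  have hd : (0:ℝ) < d := hd
  have hD : ∀ t > (0:ℝ), HasDerivAt (fun s => V s + s) (deriv V t + 1) t :=
    fun t ht => (h1 t ht).add (hasDerivAt_id t)
  have hm : MonotoneOn (fun s => V s + s) (Ioo 0 d) := by
    refine monotoneOn_of_hasDerivWithinAt_nonneg (f' := fun t => deriv V t + 1) (convex_Ioo 0 d)
      (fun t ht => (hD t ht.1).continuousAt.continuousWithinAt) ?_ ?_
    · intro t ht; rw [interior_Ioo] at ht; exact (hD t ht.1).hasDerivWithinAt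
    · intro t ht; rw [interior_Ioo] at ht
      have := hd' ht
      simp only [mem_ofPred_eq] at this
      linarith
  have hb : BddBelow ((fun s => V s + s) '' Ioo 0 d) := by
    refine ⟨0, ?_⟩
    rintro _ ⟨s, hs, rfl⟩
    exact (add_pos (hpos s hs.1) hs.1).le
  have hlim := (hm.tendsto_nhdsWithin_Ioo_right (nonempty_Ioo.2 hd) hb).sub
    (tendsto_nhdsWithin_of_tendsto_nhds (tendsto_id (x := 𝓝 (0:ℝ))))
  simp only [id, add_sub_cancel_right] at hlim
  exact ⟨_, ge_of_tendsto hlim (eventually_mem_nhdsWithin.mono fun t ht => (hpos t ht).le), hlim⟩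

/-- A function tending to `0` at infinity cannot satisfy `V'' + (k / t) V' ≥ c > 0` eventually. -/
theorem not_eventually_le_radial {V : ℝ → ℝ} {k c T : ℝ} (hk : 0 < k) (hc : 0 < c) (hT : 0 < T)
    (h1 : ∀ t > (0:ℝ), HasDerivAt V (deriv V t) t)
    (h2 : ∀ t > (0:ℝ), HasDerivAt (deriv V) (deriv (deriv V) t) t)
    (hV : Tendsto V atTop (𝓝 0)) :
    ¬ ∀ t ≥ T, c ≤ deriv (deriv V) t + k / t * deriv V t := by
  intro h
  set f : ℝ → ℝ := fun s => s ^ k * deriv V s - c / (k + 1) * s ^ (k + 1) with hf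
  have hm : MonotoneOn f (Ici T) := by
    refine monotoneOn_of_hasDerivWithinAt_nonneg
      (f' := fun t => t ^ k * (deriv (deriv V) t + k / t * deriv V t - c)) (convex_Ici T)
      (fun t ht => (hasDerivAt_flux hk (hT.trans_le ht)
        (h2 t (hT.trans_le ht))).continuousAt.continuousWithinAt) ?_ ?_
    · intro t ht; rw [interior_Ici] at ht
      exact (hasDerivAt_flux hk (hT.trans ht) (h2 t (hT.trans ht))).hasDerivWithinAt
    · intro t ht; rw [interior_Ici] at ht
      have := h t (le_of_lt ht)
      exact mul_nonneg (Real.rpow_nonneg (hT.trans ht).le _) (by linarith)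
  set b := c / (k + 1) with hb
  have hb0 : 0 < b := by positivity
  set K := |f T| / T ^ k with hK
  have hTk : 0 < T ^ k := Real.rpow_pos_of_pos hT _
  have hder : ∀ t ≥ T, b * t - K ≤ deriv V t := by
    intro t ht
    have ht0 := hT.trans_le ht
    have htk : 0 < t ^ k := Real.rpow_pos_of_pos ht0 _
    have hle : f T ≤ f t := hm self_mem_Ici ht ht
    have hft : f t = t ^ k * (deriv V t - b * t) := by
      simp only [hf]; rw [Real.rpow_add_one ht0.ne']; ring
    have hTt : T ^ k ≤ t ^ k := Real.rpow_le_rpow hT.le ht hk.le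
    have hK0 : 0 ≤ K := by positivity
    have : -(t ^ k * K) ≤ f T := by
      have h3 : T ^ k * K = |f T| := by rw [hK]; field_simp
      have h4 := mul_le_mul_of_nonneg_right hTt hK0
      have h5 := neg_abs_le (f T)
      linarith
    have h6 : t ^ k * (-K) ≤ t ^ k * (deriv V t - b * t) := by linarith
    have := le_of_mul_le_mul_left h6 htk
    linarith
  set S := max T ((K + 1) / b) with hS
  have hge : ∀ t ≥ S, 1 ≤ deriv V t := by
    intro t ht
    have h3 := hder t ((le_max_left _ _).trans ht)
    have h4 : (K + 1) / b ≤ t := (le_max_right _ _).trans ht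
    rw [div_le_iff₀ hb0] at h4
    linarith
  have hS0 : 0 < S := hT.trans_le (le_max_left _ _)
  have hD : ∀ t > (0:ℝ), HasDerivAt (fun s => V s - s) (deriv V t - 1) t :=
    fun t ht => (h1 t ht).sub (hasDerivAt_id t)
  have hm2 : MonotoneOn (fun s => V s - s) (Ici S) := by
    refine monotoneOn_of_hasDerivWithinAt_nonneg (f' := fun t => deriv V t - 1) (convex_Ici S)
      (fun t ht => (hD t (hS0.trans_le ht)).continuousAt.continuousWithinAt) ?_ ?_
    · intro t ht; rw [interior_Ici] at ht; exact (hD t (hS0.trans ht)).hasDerivWithinAt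
    · intro t ht; rw [interior_Ici] at ht
      linarith [hge t (le_of_lt ht)]
  have htop : Tendsto V atTop atTop := by
    refine tendsto_atTop_mono' atTop ?_ (tendsto_atTop_add_const_right atTop (V S - S) tendsto_id)
    filter_upwards [eventually_ge_atTop S] with t ht
    have := hm2 self_mem_Ici ht ht
    simp only [id] at *
    linarith
  exact not_tendsto_nhds_of_tendsto_atTop htop 0 hV

/-- A positive solution of a linear radial differential inequality with vanishing initial slope
has a positive initial value. -/
theorem limit_ne_zero_of_radial_le {V : ℝ → ℝ} {k C d : ℝ} (hk : 0 < k) (hC : 0 < C) (hd : 0 < d)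
    (h1 : ∀ t > (0:ℝ), HasDerivAt V (deriv V t) t)
    (h2 : ∀ t > (0:ℝ), HasDerivAt (deriv V) (deriv (deriv V) t) t)
    (hpos : ∀ t > (0:ℝ), 0 < V t) (h0 : Tendsto (deriv V) (𝓝[>] 0) (𝓝 0))
    (h : ∀ t, 0 < t → t < d → deriv (deriv V) t + k / t * deriv V t ≤ C * V t) :
    ¬ Tendsto V (𝓝[>] 0) (𝓝 0) := by
  intro hV
  obtain ⟨τ, hτ0, hτd, hτC⟩ : ∃ τ, 0 < τ ∧ τ < d ∧ C * τ ^ 2 < 1 := by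
    have h3 : Tendsto (fun τ : ℝ => C * τ ^ 2) (𝓝[>] 0) (𝓝 (C * 0 ^ 2)) :=
      tendsto_nhdsWithin_of_tendsto_nhds (Continuous.tendsto (by fun_prop) 0)
    have h4 := h3.eventually (gt_mem_nhds (show C * (0:ℝ) ^ 2 < 1 by norm_num))
    have h5 : ∀ᶠ t in 𝓝[>] (0:ℝ), t ∈ Ioo 0 d := Ioo_mem_nhdsGT hd
    obtain ⟨τ, ⟨ha, hb⟩, hc⟩ := (h5.and h4).exists
    exact ⟨τ, ha, hb, hc⟩
  obtain ⟨m, ⟨hm0, hmτ⟩, hmax⟩ : ∃ m ∈ Ioc 0 τ, ∀ t ∈ Ioc 0 τ, V t ≤ V m := by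
    obtain ⟨e, he, he'⟩ := mem_nhdsGT_iff_exists_Ioo_subset.1
      (hV.eventually (gt_mem_nhds (hpos τ hτ0)))
    have he : (0:ℝ) < e := he
    set σ := min (e / 2) τ
    have hσ : 0 < σ := lt_min (by linarith) hτ0
    have hστ : σ ≤ τ := min_le_right _ _
    obtain ⟨m, hm, hmm⟩ := isCompact_Icc.exists_isMaxOn (nonempty_Icc.2 hστ)
      (fun t ht => (h1 t (hσ.trans_le ht.1)).continuousAt.continuousWithinAt)
    refine ⟨m, ⟨hσ.trans_le hm.1, hm.2⟩, fun t ht => ?_⟩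
    rcases le_or_gt σ t with hs | hs
    · exact hmm ⟨hs, ht.2⟩
    · have h3 : V t < V τ := he' ⟨ht.1, hs.trans ((min_le_left _ _).trans_lt (by linarith))⟩
      exact h3.le.trans (hmm ⟨hστ, le_rfl⟩)
  set c := C * V m with hc
  have hc0 : 0 < c := mul_pos hC (hpos m hm0)
  have hflux : AntitoneOn (fun s => s ^ k * deriv V s - c / (k + 1) * s ^ (k + 1)) (Ioc 0 m) := by
    refine antitoneOn_of_hasDerivWithinAt_nonpos
      (f' := fun t => t ^ k * (deriv (deriv V) t + k / t * deriv V t - c)) (convex_Ioc 0 m)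
      (fun t ht => (hasDerivAt_flux hk ht.1 (h2 t ht.1)).continuousAt.continuousWithinAt) ?_ ?_
    · intro t ht; rw [interior_Ioc] at ht
      exact (hasDerivAt_flux hk ht.1 (h2 t ht.1)).hasDerivWithinAt
    · intro t ht; rw [interior_Ioc] at ht
      have h3 := h t ht.1 ((ht.2.trans_le hmτ).trans hτd)
      have h4 := mul_le_mul_of_nonneg_left (hmax t ⟨ht.1, ht.2.le.trans hmτ⟩) hC.le
      exact mul_nonpos_of_nonneg_of_nonpos (Real.rpow_nonneg ht.1.le _) (by linarith)
  have hflux0 : Tendsto (fun s => s ^ k * deriv V s - c / (k + 1) * s ^ (k + 1)) (𝓝[>] 0) (𝓝 0) := by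
    have h3 : ∀ p : ℝ, 0 < p → Tendsto (fun s : ℝ => s ^ p) (𝓝[>] 0) (𝓝 0) := fun p hp =>
      tendsto_nhdsWithin_of_tendsto_nhds (by
        simpa [Real.zero_rpow hp.ne'] using (Real.continuousAt_rpow_const 0 p (Or.inr hp.le)).tendsto)
    simpa using ((h3 k hk).mul h0).sub ((h3 (k + 1) (by linarith)).const_mul (c / (k + 1)))
  have hder : ∀ t ∈ Ioc 0 m, deriv V t ≤ c * t := by
    intro t ht
    have h3 : t ^ k * deriv V t - c / (k + 1) * t ^ (k + 1) ≤ 0 := by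
      refine ge_of_tendsto hflux0 ?_
      filter_upwards [Ioc_mem_nhdsGT ht.1] with s hs
      exact hflux ⟨hs.1, hs.2.trans ht.2⟩ ht hs.2
    have htk : 0 < t ^ k := Real.rpow_pos_of_pos ht.1 _
    have h4 : t ^ k * deriv V t ≤ t ^ k * (c / (k + 1) * t) := by
      rw [Real.rpow_add_one ht.1.ne'] at h3; linarith
    refine (le_of_mul_le_mul_left h4 htk).trans ?_
    exact mul_le_mul_of_nonneg_right (div_le_self hc0.le (by linarith)) ht.1.le
  have hanti : AntitoneOn (fun s => V s - c / 2 * s ^ 2) (Ioc 0 m) := by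
    refine antitoneOn_of_hasDerivWithinAt_nonpos (f' := fun t => deriv V t - c * t)
      (convex_Ioc 0 m)
      (fun t ht => (hasDerivAt_sub_quadratic (h1 t ht.1)).continuousAt.continuousWithinAt) ?_ ?_
    · intro t ht; rw [interior_Ioc] at ht
      exact (hasDerivAt_sub_quadratic (h1 t ht.1)).hasDerivWithinAt
    · intro t ht; rw [interior_Ioc] at ht
      linarith [hder t ⟨ht.1, ht.2.le⟩]
  have hlim : Tendsto (fun s => V s - c / 2 * s ^ 2) (𝓝[>] 0) (𝓝 (0 - c / 2 * 0 ^ 2)) :=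
    hV.sub (tendsto_nhdsWithin_of_tendsto_nhds (Continuous.tendsto (by fun_prop) 0))
  have hfin : V m - c / 2 * m ^ 2 ≤ 0 - c / 2 * 0 ^ 2 := by
    refine ge_of_tendsto hlim ?_
    filter_upwards [Ioc_mem_nhdsGT hm0] with s hs
    exact hanti hs ⟨hm0, le_rfl⟩ hs.2
  have hm2 : m ^ 2 ≤ τ ^ 2 := pow_le_pow_left₀ hm0.le hmτ 2
  have h5 : C * m ^ 2 < 1 := (mul_le_mul_of_nonneg_left hm2 hC.le).trans_lt hτC
  have h6 := mul_lt_mul_of_pos_left h5 (hpos m hm0)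
  have : V m ≤ V m * (C * m ^ 2) / 2 := by rw [hc] at hfin; linarith
  linarith [hpos m hm0]

/-- The Laplacian of a function of `‖x‖ ^ 2`. -/
theorem lap_comp_norm_sq {N : ℕ} {u : EuclideanSpace ℝ (Fin N) → ℝ} {g g' : ℝ → ℝ} {b : ℝ}
    (hu : ∀ x ≠ 0, u x = g (‖x‖ ^ 2)) (hg : ∀ s > (0:ℝ), HasDerivAt g (g' s) s)
    {x : EuclideanSpace ℝ (Fin N)} (hx : x ≠ 0) (hg' : HasDerivAt g' b (‖x‖ ^ 2)) :
    lap u x = 2 * N * g' (‖x‖ ^ 2) + 4 * ‖x‖ ^ 2 * b := by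
  have hsq : ∀ y : EuclideanSpace ℝ (Fin N),
      HasFDerivAt (fun x => ‖x‖ ^ 2) (2 • (innerSL ℝ y)) y :=
    fun y => (hasStrictFDerivAt_norm_sq y).hasFDerivAt
  have hne : ∀ y : EuclideanSpace ℝ (Fin N), y ≠ 0 → ∀ᶠ z in 𝓝 y, z ≠ 0 :=
    fun y hy => isOpen_ne.mem_nhds hy
  have hfirst : ∀ i, ∀ y : EuclideanSpace ℝ (Fin N), y ≠ 0 →
      fderiv ℝ u y (EuclideanSpace.single i 1) = g' (‖y‖ ^ 2) * (2 * y i) := by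
    intro i y hy
    have h1 := ((hg (‖y‖ ^ 2) (by positivity)).comp_hasFDerivAt y (hsq y)).congr_of_eventuallyEq
      ((hne y hy).mono hu)
    rw [h1.fderiv]
    simp [EuclideanSpace.inner_single_right]
  have hsecond : ∀ i, fderiv ℝ (fun y => fderiv ℝ u y (EuclideanSpace.single i 1)) x
      (EuclideanSpace.single i 1) = 2 * g' (‖x‖ ^ 2) + 4 * (x i) ^ 2 * b := by
    intro i
    have h1 := (hg'.comp_hasFDerivAt x (hsq x)).mul
      (((EuclideanSpace.proj i : EuclideanSpace ℝ (Fin N) →L[ℝ] ℝ).hasFDerivAt (x := x)).const_mul 2)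
    have h2 := h1.congr_of_eventuallyEq ((hne x hx).mono (hfirst i))
    rw [h2.fderiv]
    simp [EuclideanSpace.inner_single_right]
    ring
  rw [lap, Finset.sum_congr rfl fun i _ => hsecond i, Finset.sum_add_distrib, Finset.sum_const,
    ← Finset.sum_mul, ← Finset.mul_sum, ← EuclideanSpace.real_norm_sq_eq]
  simp only [Finset.card_univ, Fintype.card_fin, nsmul_eq_mul]
  ring

theorem norm_rpow_eq_norm_sq_rpow {E : Type*} [NormedAddCommGroup E] (x : E) (p : ℝ) :
    ‖x‖ ^ (2 * p) = (‖x‖ ^ 2) ^ p := by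
  rw [Real.rpow_mul (norm_nonneg x), Real.rpow_two]

theorem hasDerivAt_emdenFowler {V : ℝ → ℝ} {p s a : ℝ} (hp : 0 < p) (hs : 0 < s)
    (h : HasDerivAt V a (1 / (2 * p) * s ^ p)) :
    HasDerivAt (fun r => V (1 / (2 * p) * r ^ p)) (a * (s ^ (p - 1) / 2)) s := by
  have h1 := (Real.hasDerivAt_rpow_const (p := p) (Or.inl hs.ne')).const_mul (1 / (2 * p))
  refine (h.comp s h1).congr_deriv ?_
  field_simp

theorem lap_emdenFowler {N : ℕ} {u : EuclideanSpace ℝ (Fin N) → ℝ} {V : ℝ → ℝ} {p : ℝ} (hp : 0 < p)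
    (h1 : ∀ t > (0:ℝ), HasDerivAt V (deriv V t) t)
    (h2 : ∀ t > (0:ℝ), HasDerivAt (deriv V) (deriv (deriv V) t) t)
    (hu : ∀ x ≠ 0, u x = V (1 / (2 * p) * ‖x‖ ^ (2 * p)))
    {x : EuclideanSpace ℝ (Fin N)} (hx : x ≠ 0) {t : ℝ} (ht : t = 1 / (2 * p) * ‖x‖ ^ (2 * p)) :
    lap u x = ‖x‖ ^ (4 * p - 2) *
      (deriv (deriv V) t + (N - 2 + 2 * p) / (2 * p) / t * deriv V t) := by
  have hs : 0 < ‖x‖ ^ 2 := by positivity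
  have hτ : ∀ s > (0:ℝ), 0 < 1 / (2 * p) * s ^ p := fun s hs => by positivity
  have h3 := (hasDerivAt_emdenFowler hp hs (h2 _ (hτ _ hs))).mul
    ((Real.hasDerivAt_rpow_const (p := p - 1) (Or.inl hs.ne')).div_const 2)
  rw [lap_comp_norm_sq (fun x hx => by rw [hu x hx, norm_rpow_eq_norm_sq_rpow])
    (fun s hs => hasDerivAt_emdenFowler hp hs (h1 _ (hτ s hs))) hx h3]
  rw [show 4 * p - 2 = 2 * (p + p - 1) by ring, norm_rpow_eq_norm_sq_rpow, ht,
    norm_rpow_eq_norm_sq_rpow]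
  set s := ‖x‖ ^ 2
  have hsp : 0 < s ^ p := Real.rpow_pos_of_pos hs _
  rw [Real.rpow_sub_one hs.ne' (p - 1), Real.rpow_sub_one hs.ne' (p + p), Real.rpow_add hs,
    Real.rpow_sub_one hs.ne' p]
  field_simp
  ring

theorem stmt0 (N : ℕ) (hN : 3 ≤ N) (α : ℝ) (hα : 0 < α)
    (F : ℝ → ℝ) (hF : ContDiff ℝ 1 F)
    (V : ℝ → ℝ) (hV : ContDiffOn ℝ 2 V (Ioi 0))
    (hVpos : ∀ t > (0:ℝ), 0 < V t)
    (hode : ∀ t > (0:ℝ), -(deriv (deriv V) t) - kk N α / t * deriv V t = F (V t))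
    (hV'0 : Tendsto (deriv V) (𝓝[>] 0) (𝓝 0))
    (hVinf : Tendsto V atTop (𝓝 0)) :
    ∃ u : EuclideanSpace ℝ (Fin N) → ℝ,
      (∀ x : EuclideanSpace ℝ (Fin N), x ≠ 0 →
        u x = V (2 / (2 + α) * ‖x‖ ^ ((2 + α) / 2))) ∧
      Continuous u ∧
      (∀ x, 0 < u x) ∧
      ContDiffOn ℝ 2 u {x | x ≠ 0} ∧
      (∀ x : EuclideanSpace ℝ (Fin N), x ≠ 0 → -(lap u x) = ‖x‖ ^ α * F (u x)) ∧
      Tendsto u (comap (fun x => ‖x‖) atTop) (𝓝 0) := by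
  obtain ⟨h1, h2⟩ := hasDerivAt_deriv_of_contDiffOn_two hV
  have hN' : (3:ℝ) ≤ N := by exact_mod_cast hN
  have hk : 0 < kk N α := div_pos (by linarith) (by linarith)
  obtain ⟨l, hl, hlim⟩ := exists_tendsto_of_deriv h1 hVpos hV'0
  have hlpos : 0 < l := by
    refine hl.lt_of_ne' ?_
    rintro rfl
    have hF0 : 0 ≤ F 0 := by
      by_contra! hneg
      have h3 := ((hF.continuous.tendsto 0).comp hVinf).eventually
        (gt_mem_nhds (show F 0 < F 0 / 2 by linarith))
      obtain ⟨T, hT⟩ := eventually_atTop.1 h3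
      refine not_eventually_le_radial (c := -(F 0 / 2)) (T := max T 1) hk (by linarith)
        (by positivity) h1 h2 hVinf fun t ht => ?_
      have h4 : F (V t) < F 0 / 2 := hT t ((le_max_left _ _).trans ht)
      linarith [hode t (one_pos.trans_le ((le_max_right _ _).trans ht))]
    obtain ⟨C, hC, hCF⟩ :=
      ((hF.differentiable one_ne_zero 0).hasDerivAt.isBigO_sub).exists_pos
    obtain ⟨d, hd, hd'⟩ := mem_nhdsGT_iff_exists_Ioo_subset.1 (hlim.eventually hCF.bound)
    refine limit_ne_zero_of_radial_le hk hC hd h1 h2 hVpos hV'0 (fun t ht htd => ?_) hlim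
    have h5 : ‖F (V t) - F 0‖ ≤ C * ‖V t - 0‖ := hd' ⟨ht, htd⟩
    rw [sub_zero, Real.norm_of_nonneg (hVpos t ht).le] at h5
    have h6 := (abs_le.1 h5).1
    linarith [hode t ht]
  set W := Function.update V 0 l with hW
  have hWV : ∀ t > (0:ℝ), W t = V t := fun t ht => Function.update_of_ne ht.ne' _ _
  set τ : EuclideanSpace ℝ (Fin N) → ℝ := fun x => 2 / (2 + α) * ‖x‖ ^ ((2 + α) / 2) with hτ
  have hτ0 : ∀ x, 0 ≤ τ x := fun x => by positivity
  have hτpos : ∀ x, x ≠ 0 → 0 < τ x := fun x hx => by positivity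
  have hτV : ∀ x, x ≠ 0 → W (τ x) = V (τ x) := fun x hx => hWV _ (hτpos x hx)
  have hτcont : Continuous τ :=
    continuous_const.mul (continuous_norm.rpow_const fun _ => Or.inr (by positivity))
  refine ⟨fun x => W (τ x), hτV, ?_, ?_, ?_, ?_, ?_⟩
  · have hWc : ContinuousOn W (Ici 0) := by
      rw [hW, continuousOn_update_iff, Ici_sdiff_left]
      exact ⟨hV.continuousOn, fun _ => hlim⟩
    exact hWc.comp_continuous hτcont hτ0
  · intro x
    rcases (hτ0 x).eq_or_lt with h | h
    · simpa [← h, hW] using hlpos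
    · simpa [hWV _ h] using hVpos _ h
  · have hτs : ContDiffOn ℝ 2 τ {x | x ≠ 0} := fun x hx =>
      (contDiffAt_const.mul ((contDiffAt_norm ℝ hx).rpow_const_of_ne
        (norm_ne_zero_iff.2 hx))).contDiffWithinAt
    exact (hV.comp hτs fun x hx => hτpos x hx).congr hτV
  · intro x hx
    beta_reduce
    have hp : 0 < (2 + α) / 4 := by linarith
    have hτp : ∀ y, τ y = 1 / (2 * ((2 + α) / 4)) * ‖y‖ ^ (2 * ((2 + α) / 4)) := fun y => by
      rw [show 2 * ((2 + α) / 4) = (2 + α) / 2 by ring, one_div_div]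
    have hkk : ((N:ℝ) - 2 + 2 * ((2 + α) / 4)) / (2 * ((2 + α) / 4)) = kk N α := by
      rw [kk]; field_simp; ring
    rw [lap_emdenFowler hp h1 h2 (fun y hy => by rw [hτV y hy, hτp]) hx (hτp x), hkk, hτV x hx,
      ← hode _ (hτpos x hx), show 4 * ((2 + α) / 4) - 2 = α by ring]
    ring
  · have hτtop : Tendsto τ (comap (fun x => ‖x‖) atTop) atTop :=
      ((tendsto_rpow_atTop (by positivity)).const_mul_atTop (by positivity)).comp tendsto_comap
    refine (hVinf.comp hτtop).congr' ?_
    filter_upwards [hτtop.eventually_gt_atTop 0] with x hx using (hWV _ hx).symm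
end

section
/- Let N ≥ 3 be an integer, α > 0, and k(α) = (2N-2+α)/(2+α). Let F : ℝ → ℝ be continuous. Suppose u : ℝ^N → ℝ is a positive radial solution of -Δu = |x|^α F(u), i.e. there is U : [0,∞) → ℝ with u(x) = U(|x|), u is continuous on ℝ^N, twice continuously differentiable on ℝ^N∖{0}, satisfies -Δu(x) = |x|^α F(u(x)) for every x ≠ 0, and u(x) → 0 as |x| → ∞. Then the function V(t) = U(((2+α)t/2)^{2/(2+α)}) is in C²((0,∞)), satisfies -V''(t) - (k(α)/t)V'(t) = F(V(t)) for all t > 0, and moreover lim_{t→0⁺} V'(t) = 0 and lim_{t→∞} V(t) = 0. -/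
open MeasureTheory Filter Set Topology

theorem hasFDerivAt_norm_of_ne_zero {E : Type*} [NormedAddCommGroup E] [InnerProductSpace ℝ E]
    {x : E} (hx : x ≠ 0) : HasFDerivAt (fun y : E => ‖y‖) (‖x‖⁻¹ • innerSL ℝ x) x := by
  have hn : ‖x‖ ≠ 0 := norm_ne_zero_iff.mpr hx
  have h := (hasStrictFDerivAt_norm_sq x).hasFDerivAt.sqrt (pow_ne_zero 2 hn)
  simp only [Real.sqrt_sq (norm_nonneg _)] at h
  convert h using 1
  ext y
  simp
  field_simp

theorem HasDerivAt.hasFDerivAt_comp_norm {E : Type*} [NormedAddCommGroup E] [InnerProductSpace ℝ E]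
    {f : ℝ → ℝ} {f' : ℝ} {x : E} (hx : x ≠ 0) (hf : HasDerivAt f f' ‖x‖) :
    HasFDerivAt (fun y : E => f ‖y‖) ((f' * ‖x‖⁻¹) • innerSL ℝ x) x := by
  have h := hf.comp_hasFDerivAt x (hasFDerivAt_norm_of_ne_zero hx)
  rwa [smul_smul] at h

/-- The Laplacian of a radial function, in terms of its profile. -/
theorem lap_comp_norm {N : ℕ} {f f₁ : ℝ → ℝ} {f₂ : ℝ}
    (hf : ∀ r > 0, HasDerivAt f (f₁ r) r) {x : EuclideanSpace ℝ (Fin N)} (hx : x ≠ 0)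
    (hf₁ : HasDerivAt f₁ f₂ ‖x‖) :
    lap (fun y => f ‖y‖) x = f₂ + ((N : ℝ) - 1) / ‖x‖ * f₁ ‖x‖ := by
  have hn : 0 < ‖x‖ := norm_pos_iff.mpr hx
  have key : ∀ i : Fin N,
      fderiv ℝ (fun y : EuclideanSpace ℝ (Fin N) =>
        fderiv ℝ (fun z : EuclideanSpace ℝ (Fin N) => f ‖z‖) y (EuclideanSpace.single i 1)) x
        (EuclideanSpace.single i 1) =
      (f₂ / ‖x‖ ^ 2 - f₁ ‖x‖ / ‖x‖ ^ 3) * x i ^ 2 + f₁ ‖x‖ / ‖x‖ := by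
    intro i
    have hev : (fun y : EuclideanSpace ℝ (Fin N) =>
        fderiv ℝ (fun z : EuclideanSpace ℝ (Fin N) => f ‖z‖) y (EuclideanSpace.single i 1))
        =ᶠ[𝓝 x] fun y => (f₁ ‖y‖ * ‖y‖⁻¹) * EuclideanSpace.proj (𝕜 := ℝ) i y := by
      filter_upwards [isOpen_ne.mem_nhds hx] with y hy
      rw [((hf _ (norm_pos_iff.mpr hy)).hasFDerivAt_comp_norm hy).fderiv]
      simp [EuclideanSpace.inner_single_right]
    rw [hev.fderiv_eq]
    have h₁ := HasDerivAt.hasFDerivAt_comp_norm (f := fun r => f₁ r * r⁻¹) hx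
      (hf₁.mul (hasDerivAt_inv hn.ne'))
    have h₂ := h₁.mul (EuclideanSpace.proj (𝕜 := ℝ) i).hasFDerivAt
    rw [show (fun y : EuclideanSpace ℝ (Fin N) => f₁ ‖y‖ * ‖y‖⁻¹ *
      EuclideanSpace.proj (𝕜 := ℝ) i y) = (fun y => f₁ ‖y‖ * ‖y‖⁻¹) *
        ⇑(EuclideanSpace.proj (𝕜 := ℝ) i) from rfl, h₂.fderiv]
    simp [EuclideanSpace.inner_single_right]
    field_simp
    ring
  have hsum : ∑ i, x i ^ 2 = ‖x‖ ^ 2 := (EuclideanSpace.real_norm_sq_eq x).symm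
  simp only [lap, key]
  rw [Finset.sum_add_distrib, ← Finset.mul_sum, hsum]
  simp
  field_simp
  ring

/-- If `v` solves a radial equation with exponent `k > 1` and bounded source `g`, and `v` is
bounded near `0`, then its derivative `w` tends to `0` at `0`. -/
theorem tendsto_deriv_zero_of_bounded {k δ B M : ℝ} (hk : 1 < k) (hδ : 0 < δ)
    {v w g : ℝ → ℝ} (hv : ∀ t > 0, HasDerivAt v (w t) t)
    (hw : ∀ t > 0, HasDerivAt w (-(k / t * w t) - g t) t)
    (hB : ∀ t ∈ Ioo 0 δ, |v t| ≤ B) (hM : ∀ t ∈ Ioo 0 δ, |g t| ≤ M) :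
    Tendsto w (𝓝[>] 0) (𝓝 0) := by
  have hB0 : 0 ≤ B := (abs_nonneg _).trans (hB (δ / 2) ⟨by linarith, by linarith⟩)
  have hM0 : 0 ≤ M := (abs_nonneg _).trans (hM (δ / 2) ⟨by linarith, by linarith⟩)
  have hz : ∀ t > 0, HasDerivAt (fun s => s ^ k * w s) (-(t ^ k * g t)) t := by
    intro t ht
    refine ((Real.hasDerivAt_rpow_const (p := k) (Or.inl ht.ne')).mul (hw t ht)).congr_deriv ?_
    rw [Real.rpow_sub_one ht.ne']
    field_simp
    ring
  have hflux : ∀ t ∈ Ioo 0 δ, ∀ s ∈ Ioo 0 t,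
      |t ^ k * w t| ≤ M * t ^ k * t + 4 * B * s ^ (k - 1) := by
    rintro t ⟨ht0, htδ⟩ s ⟨hs0, hst⟩
    obtain ⟨τ, ⟨hτ₁, hτ₂⟩, hτ⟩ := exists_hasDerivAt_eq_slope v w (by linarith : s / 2 < s)
      (fun x hx => (hv x (by linarith [hx.1])).continuousAt.continuousWithinAt)
      (fun x hx => hv x (by linarith [hx.1]))
    have hτ0 : 0 < τ := by linarith
    have hwτ : τ * |w τ| ≤ 4 * B := by
      have h₁ : |w τ| * (s / 2) ≤ 2 * B := by
        have : w τ * (s / 2) = v s - v (s / 2) := by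
          rw [hτ]; field_simp; ring
        rw [← abs_of_pos (half_pos hs0), ← abs_mul, this]
        have := abs_sub (v s) (v (s / 2))
        linarith [hB s ⟨hs0, by linarith⟩, hB (s / 2) ⟨by linarith, by linarith⟩]
      nlinarith [abs_nonneg (w τ)]
    have hτk : |τ ^ k * w τ| ≤ 4 * B * s ^ (k - 1) := by
      have h₁ : τ ^ k = τ ^ (k - 1) * τ := by
        rw [Real.rpow_sub_one hτ0.ne']; field_simp
      have h₂ : τ ^ (k - 1) ≤ s ^ (k - 1) := Real.rpow_le_rpow hτ0.le hτ₂.le (by linarith)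
      rw [abs_mul, abs_of_pos (Real.rpow_pos_of_pos hτ0 k), h₁, mul_assoc, mul_comm]
      gcongr
    have hdiff := norm_image_sub_le_of_norm_deriv_le_segment' (f := fun s => s ^ k * w s)
      (C := M * t ^ k) (a := τ) (b := t)
      (fun x hx => (hz x (hτ0.trans_le hx.1)).hasDerivWithinAt) (by
        intro x hx
        have hx0 : 0 < x := hτ0.trans_le hx.1
        rw [Real.norm_eq_abs, abs_neg, abs_mul, abs_of_pos (Real.rpow_pos_of_pos hx0 k), mul_comm]
        have := Real.rpow_le_rpow hx0.le hx.2.le (by linarith : 0 ≤ k)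
        gcongr
        exact hM x ⟨hx0, hx.2.trans htδ⟩) t (right_mem_Icc.mpr (by linarith))
    have h₃ : M * t ^ k * (t - τ) ≤ M * t ^ k * t := by
      gcongr
      linarith
    rw [Real.norm_eq_abs] at hdiff
    have h₄ := abs_sub_abs_le_abs_sub (t ^ k * w t) (τ ^ k * w τ)
    linarith
  have hbound : ∀ t ∈ Ioo 0 δ, |w t| ≤ M * t := by
    rintro t ⟨ht0, htδ⟩
    have hlim : Tendsto (fun s : ℝ => M * t ^ k * t + 4 * B * s ^ (k - 1)) (𝓝[>] 0)
        (𝓝 (M * t ^ k * t)) := by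
      have h := (Real.continuousAt_rpow_const 0 (k - 1) (Or.inr (by linarith))).tendsto
      rw [Real.zero_rpow (by linarith)] at h
      simpa using ((h.mono_left nhdsWithin_le_nhds).const_mul (4 * B)).const_add (M * t ^ k * t)
    have h := ge_of_tendsto hlim (by
      filter_upwards [Ioo_mem_nhdsGT ht0] with s hs
      exact hflux t ⟨ht0, htδ⟩ s hs)
    have htk := Real.rpow_pos_of_pos ht0 k
    rw [abs_mul, abs_of_pos htk] at h
    exact le_of_mul_le_mul_left (by linarith) htk
  refine squeeze_zero_norm' (a := fun t => M * t) ?_ ?_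
  · filter_upwards [Ioo_mem_nhdsGT hδ] with t ht using hbound t ht
  · have : Tendsto (fun t : ℝ => M * t) (𝓝 0) (𝓝 (M * 0)) := tendsto_id.const_mul M
    rw [mul_zero] at this
    exact this.mono_left nhdsWithin_le_nhds

theorem stmt1 (N : ℕ) (hN : 3 ≤ N) (α : ℝ) (hα : 0 < α)
    (F : ℝ → ℝ) (hF : Continuous F)
    (u : EuclideanSpace ℝ (Fin N) → ℝ) (U : ℝ → ℝ)
    (hrad : ∀ x, u x = U ‖x‖)
    (hu : Continuous u) (hupos : ∀ x, 0 < u x)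
    (hu2 : ContDiffOn ℝ 2 u {x | x ≠ 0})
    (heq : ∀ x : EuclideanSpace ℝ (Fin N), x ≠ 0 → -(lap u x) = ‖x‖ ^ α * F (u x))
    (hdec : Tendsto u (comap (fun x => ‖x‖) atTop) (𝓝 0)) :
    ∀ V : ℝ → ℝ, (∀ t, V t = U (((2 + α) * t / 2) ^ (2 / (2 + α)))) →
      ContDiffOn ℝ 2 V (Ioi 0) ∧
      (∀ t > (0:ℝ), -(deriv (deriv V) t) - kk N α / t * deriv V t = F (V t)) ∧
      Tendsto (deriv V) (𝓝[>] 0) (𝓝 0) ∧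
      Tendsto V atTop (𝓝 0) := by
  intro V hV
  set e : EuclideanSpace ℝ (Fin N) := EuclideanSpace.single ⟨0, by omega⟩ 1 with he
  have hen : ‖e‖ = 1 := by simp [he]
  have he0 : e ≠ 0 := by
    rw [← norm_ne_zero_iff, hen]; exact one_ne_zero
  have hnorm : ∀ r : ℝ, 0 ≤ r → ‖r • e‖ = r := fun r hr => by
    rw [norm_smul, hen, mul_one, Real.norm_of_nonneg hr]
  have hUu : ∀ r : ℝ, 0 ≤ r → U r = u (r • e) := fun r hr => by rw [hrad, hnorm r hr]
  have hU2 : ContDiffOn ℝ 2 U (Ioi 0) := by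
    refine ContDiffOn.congr (f := fun r : ℝ => u (r • e)) ?_ (fun r hr => hUu r (le_of_lt hr))
    exact hu2.comp (contDiff_id.smul contDiff_const).contDiffOn
      (fun r hr => smul_ne_zero (ne_of_gt hr) he0)
  have hU₁ : ∀ r > 0, HasDerivAt U (deriv U r) r := fun r hr =>
    ((hU2.differentiableOn (by norm_num)).differentiableAt (Ioi_mem_nhds hr)).hasDerivAt
  have hU₂ : ∀ r > 0, HasDerivAt (deriv U) (deriv (deriv U) r) r := fun r hr => by
    have h : ContDiffOn ℝ 1 (deriv U) (Ioi 0) := hU2.deriv_of_isOpen isOpen_Ioi (by norm_num)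
    exact ((h.differentiableOn (by norm_num)).differentiableAt (Ioi_mem_nhds hr)).hasDerivAt
  have hODE : ∀ r > 0,
      deriv (deriv U) r + ((N : ℝ) - 1) / r * deriv U r = -(r ^ α * F (U r)) := by
    intro r hr
    have hx : r • e ≠ 0 := smul_ne_zero hr.ne' he0
    have h₁ := heq _ hx
    have h₂ := lap_comp_norm hU₁ hx (f₂ := deriv (deriv U) r)
      (by rw [hnorm r hr.le]; exact hU₂ r hr)
    rw [← funext hrad, hnorm r hr.le] at h₂
    rw [h₂, hnorm r hr.le, ← hUu r hr.le] at h₁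
    linarith
  set ρ : ℝ → ℝ := fun t => ((2 + α) * t / 2) ^ (2 / (2 + α)) with hρ
  have hα2 : 0 < 2 + α := by linarith
  have hβ : 0 < 2 / (2 + α) := by positivity
  have hρ0 : ∀ t > 0, 0 < ρ t := fun t ht => Real.rpow_pos_of_pos (by positivity) _
  have hρnn : ∀ t, 0 ≤ t → 0 ≤ ρ t := fun t ht => Real.rpow_nonneg (by positivity) _
  have hVU : V = U ∘ ρ := funext hV
  have hρpow : ∀ t > 0, ∀ p : ℝ, ρ t ^ p = ((2 + α) * t / 2) ^ (2 / (2 + α) * p) :=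
    fun t ht p => (Real.rpow_mul (by positivity) _ _).symm
  have hρ₁ : ∀ t > 0, HasDerivAt ρ (ρ t ^ (-(α / 2))) t := by
    intro t ht
    have hl : HasDerivAt (fun t : ℝ => (2 + α) * t / 2) ((2 + α) * 1 / 2) t :=
      ((hasDerivAt_id t).const_mul (2 + α)).div_const 2
    have hb : (2 + α) * t / 2 ≠ 0 := by positivity
    refine (hl.rpow_const (p := 2 / (2 + α)) (Or.inl hb)).congr_deriv ?_
    rw [hρpow t ht]
    have : 2 / (2 + α) * -(α / 2) = 2 / (2 + α) - 1 := by field_simp; ring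
    rw [this]
    field_simp
  have ht_eq : ∀ t > 0, (2 + α) * t / 2 = ρ t * ρ t ^ (α / 2) := by
    intro t ht
    rw [← Real.rpow_one_add' (hρ0 t ht).le (by positivity), hρpow t ht]
    have : 2 / (2 + α) * (1 + α / 2) = 1 := by field_simp
    rw [this, Real.rpow_one]
  have hV₁ : ∀ t > 0, HasDerivAt V (deriv U (ρ t) * ρ t ^ (-(α / 2))) t := by
    intro t ht
    rw [hVU]
    exact (hU₁ _ (hρ0 t ht)).comp t (hρ₁ t ht)
  have hV₂ : ∀ t > 0, HasDerivAt (deriv V) (-(kk N α / t * deriv V t) - F (V t)) t := by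
    intro t ht
    have hr := hρ0 t ht
    have hev : deriv V =ᶠ[𝓝 t] fun s => deriv U (ρ s) * ρ s ^ (-(α / 2)) := by
      filter_upwards [Ioi_mem_nhds ht] with s hs using (hV₁ s hs).deriv
    have h := ((hU₂ _ hr).comp t (hρ₁ t ht)).mul
      ((hρ₁ t ht).rpow_const (p := -(α / 2)) (Or.inl hr.ne'))
    refine (h.congr_of_eventuallyEq hev).congr_deriv ?_
    have hode := hODE _ hr
    have hVt : U (ρ t) = V t := (hV t).symm
    have hsq : ρ t ^ α = ρ t ^ (α / 2) * ρ t ^ (α / 2) := by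
      rw [← Real.rpow_add hr, add_halves]
    rw [hVt, hsq] at hode
    have hteq := ht_eq t ht
    rw [(hV₁ t ht).deriv, Real.rpow_sub_one hr.ne', Real.rpow_neg hr.le]
    have hq : 0 < ρ t ^ (α / 2) := Real.rpow_pos_of_pos hr _
    have htt : t = 2 * (ρ t * ρ t ^ (α / 2)) / (2 + α) := by
      rw [← hteq]; field_simp
    have hkt : kk N α / t = ((N : ℝ) - 1 + α / 2) / (ρ t * ρ t ^ (α / 2)) := by
      rw [← hteq, kk]; field_simp
    rw [hkt]
    have hFV : F (V t) = -(deriv (deriv U) (ρ t) + ((N : ℝ) - 1) / ρ t * deriv U (ρ t)) /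
        (ρ t ^ (α / 2) * ρ t ^ (α / 2)) := by
      rw [hode]; field_simp
    rw [hFV]
    simp only [Function.comp_apply]
    field_simp
    ring
  have hk : 1 < kk N α := by
    have : (3 : ℝ) ≤ N := by exact_mod_cast hN
    rw [kk, lt_div_iff₀ hα2]
    linarith
  have hρc : Continuous ρ := by
    refine Continuous.rpow_const (by fun_prop) (fun t => Or.inr hβ.le)
  have hVu : ∀ t, 0 ≤ t → V t = u (ρ t • e) := fun t ht => (hV t).trans (hUu _ (hρnn t ht))
  have hV0 : Tendsto V (𝓝[>] 0) (𝓝 (V 0)) := by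
    have hc : Continuous fun t => u (ρ t • e) := hu.comp (hρc.smul continuous_const)
    rw [hVu 0 le_rfl]
    refine ((hc.tendsto 0).mono_left nhdsWithin_le_nhds).congr' ?_
    filter_upwards [self_mem_nhdsWithin] with t ht using (hVu t (le_of_lt ht)).symm
  refine ⟨?_, fun t ht => ?_, ?_, ?_⟩
  · rw [hVU]
    refine hU2.comp (fun t ht => ?_) (fun t ht => hρ0 t ht)
    have hb : (2 + α) * t / 2 ≠ 0 := by
      have : 0 < t := ht
      positivity
    have hl : ContDiffAt ℝ 2 (fun t : ℝ => (2 + α) * t / 2) t := by fun_prop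
    exact (hl.rpow_const_of_ne hb).contDiffWithinAt
  · rw [(hV₂ t ht).deriv]
    ring
  · have hB := hV0.abs.eventually_le_const (lt_add_one |V 0|)
    have hM := ((hF.tendsto _).comp hV0).abs.eventually_le_const (lt_add_one |F (V 0)|)
    obtain ⟨δ, hδ, h⟩ := mem_nhdsGT_iff_exists_Ioo_subset.mp (hB.and hM)
    exact tendsto_deriv_zero_of_bounded hk hδ
      (fun t ht => (hV₁ t ht).differentiableAt.hasDerivAt) hV₂
      (fun t ht => (h ht).1) (fun t ht => (h ht).2)
  · have hρtop : Tendsto ρ atTop atTop := by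
      refine (tendsto_rpow_atTop hβ).comp ?_
      exact (tendsto_id.const_mul_atTop hα2).atTop_div_const two_pos
    have hcomap : Tendsto (fun t => ρ t • e) atTop (comap (fun x => ‖x‖) atTop) := by
      refine tendsto_comap_iff.mpr (hρtop.congr' ?_)
      filter_upwards [eventually_ge_atTop 0] with t ht using (hnorm _ (hρnn t ht)).symm
    refine (hdec.comp hcomap).congr' ?_
    filter_upwards [eventually_ge_atTop 0] with t ht using (hVu t ht).symm
end

section
/- Let k > 0 and let F : ℝ → ℝ be continuous. Suppose V ∈ C²((0,∞)) is bounded on (0,1), satisfies -V''(t) - (k/t)V'(t) = F(V(t)) for all t > 0, and lim_{t→0⁺} t^k V'(t) = 0. Then -t^k V'(t) = ∫₀^t s^k F(V(s)) ds for all t > 0, and consequently lim_{t→0⁺} V'(t) = 0. -/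
open MeasureTheory Filter Set Topology

/-- A function continuous on `(0, ∞)` and bounded on `(0, 1)` is integrable on `(0, t)`. -/
theorem intervalIntegrable_of_continuousOn_Ioi_of_bounded {g : ℝ → ℝ} {M t : ℝ}
    (hg : ContinuousOn g (Ioi 0)) (hM : ∀ s ∈ Ioo (0:ℝ) 1, |g s| ≤ M) (ht : 0 < t) :
    IntervalIntegrable g volume 0 t := by
  have h01 : IntervalIntegrable g volume 0 1 := by
    rw [intervalIntegrable_iff_integrableOn_Ioo_of_le zero_le_one]
    refine IntegrableOn.of_bound (by simp) ?_ M ?_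
    · exact (hg.mono Ioo_subset_Ioi_self).aestronglyMeasurable measurableSet_Ioo
    · exact (ae_restrict_iff' measurableSet_Ioo).2 (Eventually.of_forall hM)
  refine h01.trans (hg.mono fun s hs => ?_).intervalIntegrable
  exact (lt_min one_pos ht).trans_le hs.1

theorem stmt2 (k : ℝ) (hk : 0 < k) (F : ℝ → ℝ) (hF : Continuous F)
    (V : ℝ → ℝ) (hV : ContDiffOn ℝ 2 V (Ioi 0))
    (hbdd : ∃ C : ℝ, ∀ t ∈ Ioo (0:ℝ) 1, |V t| ≤ C)
    (hode : ∀ t > (0:ℝ), -(deriv (deriv V) t) - k / t * deriv V t = F (V t))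
    (hlim : Tendsto (fun t => t ^ k * deriv V t) (𝓝[>] 0) (𝓝 0)) :
    (∀ t > (0:ℝ), -(t ^ k * deriv V t) = ∫ s in (0:ℝ)..t, s ^ k * F (V s)) ∧
    Tendsto (deriv V) (𝓝[>] 0) (𝓝 0) := by
  obtain ⟨C, hC⟩ := hbdd
  obtain ⟨M, hM⟩ : ∃ M, ∀ s ∈ Ioo (0:ℝ) 1, |F (V s)| ≤ M := by
    obtain ⟨M, hM⟩ := (isCompact_Icc (a := -C) (b := C)).exists_bound_of_continuousOn
      hF.continuousOn
    exact ⟨M, fun s hs => hM _ (abs_le.1 (hC s hs))⟩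
  have hcont : ContinuousOn (fun s => s ^ k * F (V s)) (Ioi 0) :=
    (Real.continuous_rpow_const hk.le).continuousOn.mul (hF.comp_continuousOn hV.continuousOn)
  have hV' : ContDiffOn ℝ 1 (deriv V) (Ioi 0) :=
    hV.deriv_of_isOpen isOpen_Ioi (by norm_num)
  have hderiv : ∀ t > (0:ℝ), HasDerivAt (fun t => -(t ^ k * deriv V t)) (t ^ k * F (V t)) t := by
    intro t ht
    have h2 : HasDerivAt (deriv V) (deriv (deriv V) t) t :=
      ((hV'.differentiableOn one_ne_zero).differentiableAt (Ioi_mem_nhds ht)).hasDerivAt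
    refine ((Real.hasDerivAt_rpow_const (p := k) (Or.inl ht.ne')).mul h2).neg.congr_deriv ?_
    rw [← hode t ht, Real.rpow_sub_one ht.ne']
    ring
  have hint : ∀ t > (0:ℝ), -(t ^ k * deriv V t) = ∫ s in (0:ℝ)..t, s ^ k * F (V s) := by
    intro t ht
    have hbound : ∀ s ∈ Ioo (0:ℝ) 1, |s ^ k * F (V s)| ≤ M := by
      intro s hs
      rw [abs_mul, abs_of_nonneg (Real.rpow_nonneg hs.1.le k)]
      exact (mul_le_of_le_one_left (abs_nonneg _)
        (Real.rpow_le_one hs.1.le hs.2.le hk.le)).trans (hM s hs)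
    have h := intervalIntegral.integral_eq_sub_of_hasDerivAt_of_tendsto ht
      (fun s hs => hderiv s hs.1)
      (intervalIntegrable_of_continuousOn_Ioi_of_bounded hcont hbound ht)
      (by simpa using hlim.neg) ((hderiv t ht).continuousAt.tendsto.mono_left nhdsWithin_le_nhds)
    rw [h, sub_zero]
  refine ⟨hint, ?_⟩
  have hM' : Tendsto (fun t : ℝ => M * t) (𝓝[>] 0) (𝓝 0) := by
    simpa using (tendsto_id.const_mul M).mono_left (nhdsWithin_le_nhds (a := (0:ℝ)) (s := Ioi 0))
  refine squeeze_zero_norm' ?_ hM'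
  filter_upwards [Ioo_mem_nhdsGT (zero_lt_one (α := ℝ))] with t ht
  have htk : 0 < t ^ k := Real.rpow_pos_of_pos ht.1 k
  have h : ‖∫ s in (0:ℝ)..t, s ^ k * F (V s)‖ ≤ t ^ k * M * |t - 0| := by
    refine intervalIntegral.norm_integral_le_of_norm_le_const fun s hs => ?_
    rw [uIoc_of_le ht.1.le] at hs
    rw [norm_mul, Real.norm_of_nonneg (Real.rpow_nonneg hs.1.le k)]
    exact mul_le_mul (Real.rpow_le_rpow hs.1.le hs.2 hk.le)
      (hM s ⟨hs.1, hs.2.trans_lt ht.2⟩) (norm_nonneg _) htk.le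
  rw [← hint t ht.1, norm_neg, norm_mul, Real.norm_of_nonneg htk.le, sub_zero,
    abs_of_pos ht.1, mul_assoc] at h
  exact le_of_mul_le_mul_left h htk
end
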